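/- Let G₁ and G₂ be groups and G = G₁ ∗ G₂ their free product. For j = 1, 2 let M_j and N_j be left ℤ[G_j]-modules, let φ_j : M_j → N_j be ℤ[G_j]-linear, and let L_j(φ_j) = id_{ℤ[G]} ⊗ φ_j : ℤ[G] ⊗_{ℤ[G_j]} M_j → ℤ[G] ⊗_{ℤ[G_j]} N_j be the induced ℤ[G]-linear map. If the direct sum L₁(φ₁) ⊕ L₂(φ₂) : L₁(M₁) ⊕ L₂(M₂) → L₁(N₁) ⊕ L₂(N₂) is a homotopy equivalence of ℤ[G]-modules, then φ₁ is a homotopy equivalence of ℤ[G₁]-modules and φ₂ is a homotopy equivalence of ℤ[G₂]-modules. -/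

import Mathlib

universe u₁ u₂ u₃

/-- A module homomorphism is null-homotopic if it factors through a projective module. -/
def FactorsThroughProjective {R : Type u₁} [Ring R] {M : Type u₂} {N : Type u₃}
    [AddCommGroup M] [AddCommGroup N] [Module R M] [Module R N]
    (f : M →ₗ[R] N) : Prop :=
  ∃ (P : Type (max u₁ u₂ u₃)) (_ : AddCommGroup P) (_ : Module R P)
    (_ : Module.Projective R P) (α : M →ₗ[R] P) (β : P →ₗ[R] N), β.comp α = f

/-- A homotopy equivalence of modules: a homomorphism invertible up to maps factoring
through projective modules. -/
def ModuleHomotopyEquiv {R : Type u₁} [Ring R] {M : Type u₂} {N : Type u₃}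
    [AddCommGroup M] [AddCommGroup N] [Module R M] [Module R N]
    (f : M →ₗ[R] N) : Prop :=
  ∃ g : N →ₗ[R] M, FactorsThroughProjective (g.comp f - LinearMap.id) ∧
    FactorsThroughProjective (f.comp g - LinearMap.id)

open TensorProduct in
/-- The extension of scalars `L(M) = ℤ[K] ⊗_{ℤ[H]} M` along a homomorphism `f : H → K`,
realised as the quotient of `ℤ[K] ⊗_ℤ M` by the relations `(μ·f(r)) ⊗ m - μ ⊗ (r·m)`. -/
noncomputable abbrev LMod {H K : Type*} [Group H] [Group K] (f : H →* K)
    (M : Type*) [AddCommGroup M] [Module (MonoidAlgebra ℤ H) M] :=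
  (TensorProduct ℤ (MonoidAlgebra ℤ K) M) ⧸ Submodule.span (MonoidAlgebra ℤ K)
    {x : TensorProduct ℤ (MonoidAlgebra ℤ K) M |
      ∃ (μ : MonoidAlgebra ℤ K) (r : MonoidAlgebra ℤ H) (m : M),
        x = (μ * MonoidAlgebra.mapDomainRingHom ℤ f r) ⊗ₜ[ℤ] m - μ ⊗ₜ[ℤ] (r • m)}

universe u₄

theorem FactorsThroughProjective.of_comp_eq {R : Type u₁} [Ring R] {M : Type u₂} {N : Type u₃}
    {P : Type u₄} [AddCommGroup M] [AddCommGroup N] [AddCommGroup P]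
    [Module R M] [Module R N] [Module R P] [Module.Projective R P]
    (α : M →ₗ[R] P) (β : P →ₗ[R] N) {f : M →ₗ[R] N}
    (hf : β.comp α = f) : FactorsThroughProjective f := by
  obtain ⟨γ, hγ⟩ := Module.projective_lifting_property
    (Finsupp.linearCombination R (id : N → N)) β (Finsupp.linearCombination_id_surjective R N)
  let e : ULift.{u₂} (N →₀ R) ≃ₗ[R] (N →₀ R) := ULift.moduleEquiv
  refine ⟨ULift.{u₂} (N →₀ R), inferInstance, inferInstance, .of_equiv e.symm,
    e.symm.toLinearMap ∘ₗ γ ∘ₗ α, Finsupp.linearCombination R id ∘ₗ e.toLinearMap, ?_⟩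
  rw [← hf, ← hγ]
  ext x
  simp

section Retract

variable {R S : Type*} [Ring R] [Ring S] {ι : R →+* S} {π : S →+* R}
  [RingHomCompTriple ι π (RingHom.id R)]
  {M N A B : Type*} [AddCommGroup M] [AddCommGroup N] [AddCommGroup A] [AddCommGroup B]
  [Module R M] [Module R N] [Module S A] [Module S B]

/-- Null-homotopic maps are preserved by passing to a retract of rings. -/
theorem FactorsThroughProjective.semilinear_comp {f : A →ₗ[S] B}
    (hf : FactorsThroughProjective f) (i : M →ₛₗ[ι] A) (p : B →ₛₗ[π] N) :
    FactorsThroughProjective (p.comp (f.comp i) : M →ₗ[R] N) := by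
  obtain ⟨P, _, _, hP, α, β, rfl⟩ := hf
  obtain ⟨s, hs⟩ := Module.projective_def'.mp hP
  let c : (P →₀ S) →ₛₗ[π] (P →₀ R) :=
    { Finsupp.mapRange.addMonoidHom π.toAddMonoidHom with
      map_smul' := fun r x => by ext; simp }
  refine .of_comp_eq (c.comp (s.comp (α.comp i)) : M →ₗ[R] P →₀ R)
    (Finsupp.linearCombination R fun x => p (β x)) ?_
  have key (x : P →₀ S) : Finsupp.linearCombination R (fun x => p (β x)) (c x) =
      p (β (Finsupp.linearCombination S id x)) := by
    induction x using Finsupp.induction_linear with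
    | zero => simp
    | add x y hx hy => simp only [map_add, hx, hy]
    | single a b => simp [c]
  ext m
  have := LinearMap.congr_fun hs (α (i m))
  simp only [LinearMap.comp_apply, LinearMap.id_apply] at this
  simp [key, this]

/-- A map which is a retract, along a retract of rings, of a homotopy equivalence
is a homotopy equivalence. -/
theorem ModuleHomotopyEquiv.of_retract {φ : M →ₗ[R] N} {Φ : A →ₗ[S] B}
    (h : ModuleHomotopyEquiv Φ) (iM : M →ₛₗ[ι] A) (iN : N →ₛₗ[ι] B)
    (pM : A →ₛₗ[π] M) (pN : B →ₛₗ[π] N)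
    (hi : ∀ m, Φ (iM m) = iN (φ m)) (hp : ∀ a, pN (Φ a) = φ (pM a))
    (hM : ∀ m, pM (iM m) = m) (hN : ∀ n, pN (iN n) = n) : ModuleHomotopyEquiv φ := by
  obtain ⟨g, hg, hg'⟩ := h
  refine ⟨(pM.comp (g.comp iN) : N →ₗ[R] M), ?_, ?_⟩
  · convert hg.semilinear_comp iM pM using 1
    ext m
    simp [hi, hM]
  · convert hg'.semilinear_comp iN pN using 1
    ext n
    simp [hp, hN]

theorem ModuleHomotopyEquiv.of_prodMap_left {C D : Type*} [AddCommGroup C] [AddCommGroup D]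
    [Module S C] [Module S D] {f : A →ₗ[S] B} {g : C →ₗ[S] D}
    (h : ModuleHomotopyEquiv (f.prodMap g)) : ModuleHomotopyEquiv f :=
  h.of_retract (LinearMap.inl S A C) (LinearMap.inl S B D) (LinearMap.fst S A C)
    (LinearMap.fst S B D) (by simp) (by simp) (by simp) (by simp)

theorem ModuleHomotopyEquiv.of_prodMap_right {C D : Type*} [AddCommGroup C] [AddCommGroup D]
    [Module S C] [Module S D] {f : A →ₗ[S] B} {g : C →ₗ[S] D}
    (h : ModuleHomotopyEquiv (f.prodMap g)) : ModuleHomotopyEquiv g :=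
  h.of_retract (LinearMap.inr S A C) (LinearMap.inr S B D) (LinearMap.snd S A C)
    (LinearMap.snd S B D) (by simp) (by simp) (by simp) (by simp)

end Retract

namespace LMod

variable {H K : Type*} [Group H] [Group K]

section Unit

variable (f : H →* K) (M : Type*) [AddCommGroup M] [Module (MonoidAlgebra ℤ H) M]

open TensorProduct in
/-- The unit `M → ℤ[K] ⊗_{ℤ[H]} M`, `m ↦ 1 ⊗ m`. -/
noncomputable def unit : M →ₛₗ[MonoidAlgebra.mapDomainRingHom ℤ f] LMod f M where
  toFun m := Submodule.Quotient.mk (1 ⊗ₜ[ℤ] m)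
  map_add' x y := by rw [TensorProduct.tmul_add, Submodule.Quotient.mk_add]
  map_smul' r m := by
    rw [← Submodule.Quotient.mk_smul, TensorProduct.smul_tmul', eq_comm, Submodule.Quotient.eq]
    exact Submodule.subset_span ⟨1, r, m, by rw [one_mul, smul_eq_mul, mul_one]⟩

end Unit

section Counit

variable (f : H →* K) (q : K →* H)
  (M : Type*) [AddCommGroup M] [Module (MonoidAlgebra ℤ H) M]

/-- The map `ℤ[K] ⊗ M → M`, `μ ⊗ m ↦ q(μ) m`. -/
noncomputable def tensorCounit :
    TensorProduct ℤ (MonoidAlgebra ℤ K) M →ₛₗ[MonoidAlgebra.mapDomainRingHom ℤ q] M :=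
  let t : TensorProduct ℤ (MonoidAlgebra ℤ K) M →ₗ[ℤ] M := TensorProduct.lift (LinearMap.mk₂ ℤ
    (fun (μ : MonoidAlgebra ℤ K) (m : M) => MonoidAlgebra.mapDomainRingHom ℤ q μ • m)
    (fun _ _ _ => by rw [map_add, add_smul])
    (fun _ _ _ => by rw [map_zsmul, smul_assoc])
    (fun _ _ _ => smul_add _ _ _)
    (fun _ _ _ => smul_comm _ _ _))
  { toFun := t
    map_add' := map_add t
    map_smul' := fun r x => by
      induction x using TensorProduct.induction_on with
      | zero => simp
      | add x y hx hy => rw [smul_add, map_add, map_add, smul_add, hx, hy]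
      | tmul μ m =>
        rw [TensorProduct.smul_tmul']
        change MonoidAlgebra.mapDomainRingHom ℤ q (r * μ) • m =
          MonoidAlgebra.mapDomainRingHom ℤ q r • MonoidAlgebra.mapDomainRingHom ℤ q μ • m
        rw [map_mul, mul_smul] }

open TensorProduct in
theorem tensorCounit_tmul (μ : MonoidAlgebra ℤ K) (m : M) :
    tensorCounit q M (μ ⊗ₜ[ℤ] m) = MonoidAlgebra.mapDomainRingHom ℤ q μ • m :=
  rfl

/-- For a retraction `q` of `f`, the map `ℤ[K] ⊗_{ℤ[H]} M → M`, `μ ⊗ m ↦ q(μ) m`. -/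
noncomputable def counit [RingHomCompTriple (MonoidAlgebra.mapDomainRingHom ℤ f)
    (MonoidAlgebra.mapDomainRingHom ℤ q) (RingHom.id (MonoidAlgebra ℤ H))] :
    LMod f M →ₛₗ[MonoidAlgebra.mapDomainRingHom ℤ q] M :=
  Submodule.liftQ _ (tensorCounit q M) <| Submodule.span_le.mpr <| by
    rintro _ ⟨μ, r, m, rfl⟩
    simp only [SetLike.mem_coe, LinearMap.mem_ker]
    rw [map_sub, tensorCounit_tmul, tensorCounit_tmul, map_mul,
      RingHomCompTriple.comp_apply, RingHom.id_apply, mul_smul, sub_self]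

variable [RingHomCompTriple (MonoidAlgebra.mapDomainRingHom ℤ f)
    (MonoidAlgebra.mapDomainRingHom ℤ q) (RingHom.id (MonoidAlgebra ℤ H))]

open TensorProduct in
theorem counit_mk_tmul (μ : MonoidAlgebra ℤ K) (m : M) :
    counit f q M (Submodule.Quotient.mk (μ ⊗ₜ[ℤ] m)) =
      MonoidAlgebra.mapDomainRingHom ℤ q μ • m :=
  rfl

theorem counit_unit (m : M) : counit f q M (unit f M m) = m :=
  (counit_mk_tmul f q M 1 m).trans (by rw [map_one, one_smul])

open TensorProduct in
theorem counit_naturality {M N : Type*} [AddCommGroup M] [Module (MonoidAlgebra ℤ H) M]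
    [AddCommGroup N] [Module (MonoidAlgebra ℤ H) N] {φ : M →ₗ[MonoidAlgebra ℤ H] N}
    {Φ : LMod f M →ₗ[MonoidAlgebra ℤ K] LMod f N}
    (hΦ : ∀ (μ : MonoidAlgebra ℤ K) (m : M),
      Φ (Submodule.Quotient.mk (μ ⊗ₜ[ℤ] m)) = Submodule.Quotient.mk (μ ⊗ₜ[ℤ] (φ m)))
    (a : LMod f M) : counit f q N (Φ a) = φ (counit f q M a) := by
  obtain ⟨x, rfl⟩ := Submodule.Quotient.mk_surjective _ a
  induction x using TensorProduct.induction_on with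
  | zero => rw [Submodule.Quotient.mk_zero]; simp only [map_zero]
  | add x y hx hy => rw [Submodule.Quotient.mk_add]; simp only [map_add, hx, hy]
  | tmul μ m => rw [hΦ, counit_mk_tmul, counit_mk_tmul, map_smul]

end Counit

open TensorProduct in
/-- If `f : H → K` admits a retraction, then extension of scalars along `f` reflects homotopy
equivalences. -/
theorem homotopyEquiv_of_retraction {f : H →* K} {q : K →* H} (hq : q.comp f = MonoidHom.id H)
    {M N : Type*} [AddCommGroup M] [Module (MonoidAlgebra ℤ H) M]
    [AddCommGroup N] [Module (MonoidAlgebra ℤ H) N] {φ : M →ₗ[MonoidAlgebra ℤ H] N}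
    {Φ : LMod f M →ₗ[MonoidAlgebra ℤ K] LMod f N}
    (hΦ : ∀ (μ : MonoidAlgebra ℤ K) (m : M),
      Φ (Submodule.Quotient.mk (μ ⊗ₜ[ℤ] m)) = Submodule.Quotient.mk (μ ⊗ₜ[ℤ] (φ m)))
    (h : ModuleHomotopyEquiv Φ) : ModuleHomotopyEquiv φ := by
  have : RingHomCompTriple (MonoidAlgebra.mapDomainRingHom ℤ f)
      (MonoidAlgebra.mapDomainRingHom ℤ q) (RingHom.id (MonoidAlgebra ℤ H)) :=
    ⟨by rw [← MonoidAlgebra.mapDomainRingHom_comp, hq, MonoidAlgebra.mapDomainRingHom_id]⟩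
  exact h.of_retract (unit f M) (unit f N) (counit f q M) (counit f q N) (hΦ 1)
    (counit_naturality f q hΦ) (counit_unit f q M) (counit_unit f q N)

end LMod

open TensorProduct in
/-- If `G = G₁ ∗ G₂` and the direct sum `L₁(φ₁) ⊕ L₂(φ₂)` of the induced maps is a homotopy
equivalence of `ℤ[G]`-modules, then each `φⱼ` is a homotopy equivalence of
`ℤ[Gⱼ]`-modules. -/
theorem homotopyEquiv_of_free_product (G₁ G₂ : Type*) [Group G₁] [Group G₂]
    (M₁ N₁ : Type*) [AddCommGroup M₁] [AddCommGroup N₁]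
    [Module (MonoidAlgebra ℤ G₁) M₁] [Module (MonoidAlgebra ℤ G₁) N₁]
    (M₂ N₂ : Type*) [AddCommGroup M₂] [AddCommGroup N₂]
    [Module (MonoidAlgebra ℤ G₂) M₂] [Module (MonoidAlgebra ℤ G₂) N₂]
    (φ₁ : M₁ →ₗ[MonoidAlgebra ℤ G₁] N₁) (φ₂ : M₂ →ₗ[MonoidAlgebra ℤ G₂] N₂)
    (Φ₁ : LMod (Monoid.Coprod.inl : G₁ →* Monoid.Coprod G₁ G₂) M₁
      →ₗ[MonoidAlgebra ℤ (Monoid.Coprod G₁ G₂)]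
        LMod (Monoid.Coprod.inl : G₁ →* Monoid.Coprod G₁ G₂) N₁)
    (hΦ₁ : ∀ (μ : MonoidAlgebra ℤ (Monoid.Coprod G₁ G₂)) (m : M₁),
      Φ₁ (Submodule.Quotient.mk (μ ⊗ₜ[ℤ] m)) = Submodule.Quotient.mk (μ ⊗ₜ[ℤ] (φ₁ m)))
    (Φ₂ : LMod (Monoid.Coprod.inr : G₂ →* Monoid.Coprod G₁ G₂) M₂
      →ₗ[MonoidAlgebra ℤ (Monoid.Coprod G₁ G₂)]
        LMod (Monoid.Coprod.inr : G₂ →* Monoid.Coprod G₁ G₂) N₂)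
    (hΦ₂ : ∀ (μ : MonoidAlgebra ℤ (Monoid.Coprod G₁ G₂)) (m : M₂),
      Φ₂ (Submodule.Quotient.mk (μ ⊗ₜ[ℤ] m)) = Submodule.Quotient.mk (μ ⊗ₜ[ℤ] (φ₂ m)))
    (h : ModuleHomotopyEquiv (Φ₁.prodMap Φ₂)) :
    ModuleHomotopyEquiv φ₁ ∧ ModuleHomotopyEquiv φ₂ := by
  exact ⟨LMod.homotopyEquiv_of_retraction Monoid.Coprod.fst_comp_inl hΦ₁ h.of_prodMap_left,
    LMod.homotopyEquiv_of_retraction Monoid.Coprod.snd_comp_inr hΦ₂ h.of_prodMap_right⟩
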